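/- Let y : D → ℕ be a counting function with coefficients c_α, let I ⊆ {1,…,m} and let J = I^c be its complement. Write each ζ ∈ D as ζ = (ζ_I, ζ_J) and define the margin R_I(ζ_I) = Σ_{ζ_J ∈ D_J} y(ζ_I, ζ_J), where D_J = Π_{j∈J} Ω_{n_j}. Then R_I is constant on D_I = Π_{j∈I} Ω_{n_j} (i.e. the fraction factorially projects onto the I-factors) if and only if c_α = 0 for every nonzero α ∈ L with α_j = 0 for all j ∈ J. -/

import Mathlib

open scoped BigOperators Classical

/-- The interaction term `X^α` on the full factorial design, where a design
point `ζ` is coded by its exponents: the `j`-th coordinate of the point is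
`exp(2πi ζ_j / n_j)`, and `X^α(ζ) = ∏_j exp(2πi α_j ζ_j / n_j)`. -/
noncomputable def Xterm (m : ℕ) (n : Fin m → ℕ) (α ζ : ∀ j, ZMod (n j)) : ℂ :=
  ∏ j, Complex.exp (2 * (Real.pi : ℂ) * Complex.I * ((α j).val : ℂ) * ((ζ j).val : ℂ) / (n j : ℂ))

/-- The coefficient `c_α = (1/#D) Σ_{ζ∈D} y(ζ)·conj(X^α(ζ))` of the counting
function `y` of a fraction. -/
noncomputable def coeff (m : ℕ) (n : Fin m → ℕ) [∀ j, NeZero (n j)]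
    (y : (∀ j, ZMod (n j)) → ℕ) (α : ∀ j, ZMod (n j)) : ℂ :=
  (∏ j, (n j : ℂ))⁻¹ * ∑ ζ : ∀ j, ZMod (n j), (y ζ : ℂ) * (starRingEnd ℂ) (Xterm m n α ζ)

theorem ZMod.stdAddChar_val_mul_val {N : ℕ} [NeZero N] (a b : ZMod N) :
    Complex.exp (2 * (Real.pi : ℂ) * Complex.I * (a.val : ℂ) * (b.val : ℂ) / (N : ℂ)) =
      ZMod.stdAddChar (a * b) := by
  have h := ZMod.stdAddChar_coe (N := N) ((a.val : ℤ) * (b.val : ℤ))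
  simp only [Int.cast_mul, Int.cast_natCast, ZMod.natCast_zmod_val] at h
  rw [h]
  congr 1
  ring

theorem Xterm_eq_prod_stdAddChar {m : ℕ} {n : Fin m → ℕ} [∀ j, NeZero (n j)]
    (α ζ : ∀ j, ZMod (n j)) : Xterm m n α ζ = ∏ j, ZMod.stdAddChar (α j * ζ j) :=
  Finset.prod_congr rfl fun _ _ => ZMod.stdAddChar_val_mul_val _ _

theorem conj_Xterm {m : ℕ} {n : Fin m → ℕ} [∀ j, NeZero (n j)] (α ζ : ∀ j, ZMod (n j)) :
    (starRingEnd ℂ) (Xterm m n α ζ) = ∏ j, ZMod.stdAddChar (-(α j * ζ j)) := by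
  simp only [Xterm_eq_prod_stdAddChar, map_prod, AddChar.map_neg_eq_conj]

/-- The points of the full design whose coordinates outside `I` vanish. -/
noncomputable def supportedOn {m : ℕ} (n : Fin m → ℕ) [∀ j, NeZero (n j)] (I : Finset (Fin m)) :
    Finset (∀ j, ZMod (n j)) :=
  Fintype.piFinset fun j => if j ∈ I then Finset.univ else {0}

theorem mem_supportedOn {m : ℕ} {n : Fin m → ℕ} [∀ j, NeZero (n j)] {I : Finset (Fin m)}
    {α : ∀ j, ZMod (n j)} : α ∈ supportedOn n I ↔ ∀ j ∉ I, α j = 0 := by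
  simp only [supportedOn, Fintype.mem_piFinset]
  refine forall_congr' fun j => ?_
  by_cases hj : j ∈ I <;> simp [hj]

/-- Orthogonality of characters on the `I`-factors. -/
theorem sum_supportedOn_prod_stdAddChar {m : ℕ} {n : Fin m → ℕ} [∀ j, NeZero (n j)]
    (I : Finset (Fin m)) (β : ∀ j, ZMod (n j)) :
    ∑ α ∈ supportedOn n I, ∏ j, ZMod.stdAddChar (α j * β j) =
      if ∀ j ∈ I, β j = 0 then ∏ j ∈ I, (n j : ℂ) else 0 := by
  have hfactor : ∀ j, ∑ a ∈ (if j ∈ I then Finset.univ else {0} : Finset (ZMod (n j))),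
      ZMod.stdAddChar (a * β j) = if j ∈ I then (if β j = 0 then (n j : ℂ) else 0) else 1 := by
    intro j
    by_cases hj : j ∈ I
    · simp only [hj, if_true, AddChar.sum_mulShift (β j) (ZMod.isPrimitive_stdAddChar (n j)),
        ZMod.card]
      split_ifs <;> simp
    · simp [hj]
  rw [supportedOn, ← Finset.prod_univ_sum (fun j => if j ∈ I then Finset.univ else {0})
    (fun j a => ZMod.stdAddChar (a * β j)), Finset.prod_congr rfl fun j _ => hfactor j,
    Finset.prod_ite_mem, Finset.univ_inter]
  split_ifs with h
  · exact Finset.prod_congr rfl fun j hj => if_pos (h j hj)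
  · push Not at h
    obtain ⟨j, hj, hβ⟩ := h
    exact Finset.prod_eq_zero hj (if_neg hβ)

/-- The margin of a counting function on the `I`-factors. -/
noncomputable def margin {m : ℕ} {n : Fin m → ℕ} [∀ j, NeZero (n j)]
    (y : (∀ j, ZMod (n j)) → ℕ) (I : Finset (Fin m)) (ζ : ∀ j, ZMod (n j)) : ℕ :=
  ∑ η ∈ Finset.univ.filter (fun η : ∀ j, ZMod (n j) => ∀ j ∈ I, η j = ζ j), y η

theorem prod_natCast_ne_zero {m : ℕ} {n : Fin m → ℕ} [∀ j, NeZero (n j)] (I : Finset (Fin m)) :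
    ∏ j ∈ I, (n j : ℂ) ≠ 0 :=
  Finset.prod_ne_zero_iff.2 fun j _ => Nat.cast_ne_zero.2 (NeZero.ne (n j))

/-- Coefficients supported on the `I`-factors are Fourier coefficients of the margin. -/
theorem coeff_eq_sum_margin {m : ℕ} {n : Fin m → ℕ} [∀ j, NeZero (n j)]
    (y : (∀ j, ZMod (n j)) → ℕ) {I : Finset (Fin m)} {α : ∀ j, ZMod (n j)}
    (hα : ∀ j ∉ I, α j = 0) :
    coeff m n y α = (∏ j, (n j : ℂ))⁻¹ *
      ∑ ζ ∈ supportedOn n I, (margin y I ζ : ℂ) * (starRingEnd ℂ) (Xterm m n α ζ) := by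
  rw [coeff]
  congr 1
  let ρ : (∀ j, ZMod (n j)) → ∀ j, ZMod (n j) := fun η j => if j ∈ I then η j else 0
  have hρ : ∀ η ∈ Finset.univ, ρ η ∈ supportedOn n I := fun η _ =>
    mem_supportedOn.2 fun j hj => if_neg hj
  rw [← Finset.sum_fiberwise_of_maps_to hρ]
  refine Finset.sum_congr rfl fun ζ hζ => ?_
  rw [mem_supportedOn] at hζ
  have hfiber : ∀ η, ρ η = ζ ↔ ∀ j ∈ I, η j = ζ j := by
    refine fun η => funext_iff.trans (forall_congr' fun j => ?_)
    by_cases hj : j ∈ I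
    · simp [ρ, hj]
    · simp [ρ, hj, hζ j hj]
  simp only [hfiber, margin, Nat.cast_sum, Finset.sum_mul]
  refine Finset.sum_congr rfl fun η hη => ?_
  have hη : ∀ j ∈ I, η j = ζ j := (Finset.mem_filter.1 hη).2
  congr 2
  simp only [Xterm_eq_prod_stdAddChar]
  refine Finset.prod_congr rfl fun j _ => ?_
  by_cases hj : j ∈ I
  · rw [hη j hj]
  · simp [hα j hj]

/-- Fourier inversion for the margin. -/
theorem prod_mul_margin {m : ℕ} {n : Fin m → ℕ} [∀ j, NeZero (n j)]
    (y : (∀ j, ZMod (n j)) → ℕ) (I : Finset (Fin m)) (ζ : ∀ j, ZMod (n j)) :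
    (∏ j ∈ I, (n j : ℂ)) * margin y I ζ =
      (∏ j, (n j : ℂ)) * ∑ α ∈ supportedOn n I, coeff m n y α * Xterm m n α ζ := by
  have hind : ∀ η : ∀ j, ZMod (n j),
      ∑ α ∈ supportedOn n I, (starRingEnd ℂ) (Xterm m n α η) * Xterm m n α ζ =
        if ∀ j ∈ I, η j = ζ j then ∏ j ∈ I, (n j : ℂ) else 0 := by
    intro η
    have h := sum_supportedOn_prod_stdAddChar I (ζ - η)
    simp only [Pi.sub_apply, sub_eq_zero, @eq_comm _ (ζ _)] at h
    rw [← h]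
    refine Finset.sum_congr rfl fun α _ => ?_
    rw [conj_Xterm, Xterm_eq_prod_stdAddChar, ← Finset.prod_mul_distrib]
    refine Finset.prod_congr rfl fun j _ => ?_
    rw [← AddChar.map_add_eq_mul]
    congr 1
    ring
  calc (∏ j ∈ I, (n j : ℂ)) * margin y I ζ
      = ∑ η, (y η : ℂ) * if ∀ j ∈ I, η j = ζ j then ∏ j ∈ I, (n j : ℂ) else 0 := by
        simp only [margin, Nat.cast_sum, Finset.mul_sum, Finset.sum_filter, Nat.cast_ite,
          Nat.cast_zero, mul_ite, mul_zero, zero_mul, mul_comm]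
    _ = ∑ α ∈ supportedOn n I,
          (∑ η, (y η : ℂ) * (starRingEnd ℂ) (Xterm m n α η)) * Xterm m n α ζ := by
        simp only [← hind, Finset.mul_sum, Finset.sum_mul, mul_assoc]
        exact Finset.sum_comm
    _ = _ := by
        rw [Finset.mul_sum]
        refine Finset.sum_congr rfl fun α _ => ?_
        rw [coeff, ← mul_assoc, mul_inv_cancel_left₀ (prod_natCast_ne_zero _)]

/-- A fraction factorially projects onto the `I`-factors (the margin
`R_I(ζ_I) = Σ_{ζ_J} y(ζ_I, ζ_J)` is constant) iff `c_α = 0` for every nonzero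
`α` supported on the `I`-factors (i.e. with `α_j = 0` for all `j ∉ I`). -/
theorem projects_iff_coeffs_zero (m : ℕ) (hm : 1 ≤ m) (n : Fin m → ℕ) [∀ j, NeZero (n j)]
    (y : (∀ j, ZMod (n j)) → ℕ) (I : Finset (Fin m)) :
    (∀ ζ ζ' : ∀ j, ZMod (n j),
        (∑ η ∈ Finset.univ.filter (fun η : ∀ j, ZMod (n j) => ∀ j ∈ I, η j = ζ j), y η) =
        (∑ η ∈ Finset.univ.filter (fun η : ∀ j, ZMod (n j) => ∀ j ∈ I, η j = ζ' j), y η)) ↔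
      (∀ α : ∀ j, ZMod (n j), α ≠ 0 → (∀ j ∉ I, α j = 0) → coeff m n y α = 0) := by
  change (∀ ζ ζ', margin y I ζ = margin y I ζ') ↔ _
  constructor
  · intro h α hα hsupp
    have hα' : ¬ ∀ j ∈ I, -α j = 0 := fun hI => hα <| funext fun j => by
      by_cases hj : j ∈ I
      · exact neg_eq_zero.1 (hI j hj)
      · exact hsupp j hj
    have horth := sum_supportedOn_prod_stdAddChar I (-α)
    simp only [Pi.neg_apply, if_neg hα'] at horth
    rw [coeff_eq_sum_margin y hsupp, Finset.sum_congr rfl fun ζ _ => by rw [h ζ 0],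
      ← Finset.mul_sum]
    simp only [conj_Xterm, ← neg_mul, mul_comm _ (_ : ZMod _), horth, mul_zero]
  · intro h
    have hconst : ∀ ζ, (∏ j ∈ I, (n j : ℂ)) * margin y I ζ = (∏ j, (n j : ℂ)) * coeff m n y 0 := by
      intro ζ
      rw [prod_mul_margin, Finset.sum_eq_single 0]
      · simp [Xterm]
      · intro α hα hne
        rw [h α hne (mem_supportedOn.1 hα), zero_mul]
      · exact fun h0 => absurd (mem_supportedOn.2 fun _ _ => rfl) h0
    intro ζ ζ'
    exact_mod_cast mul_left_cancel₀ (prod_natCast_ne_zero I) ((hconst ζ).trans (hconst ζ').symm)
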